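/- The algorithm does not depend on the initial conditions: if b⁰ and c⁰ are any two initial bias vectors and b*, c* : U → ℝ are pointwise limits of the respective iterate sequences b^{t+1} = T(b^{t}) and c^{t+1} = T(c^{t}), then b* = c*. -/

import Mathlib

open Finset

noncomputable def clamp (x : ℝ) : ℝ := max 0 (min 1 x)

/-- The set of users rating object `j`. -/
def dminus {U O : Type} [Fintype U] [DecidableEq O] (dplus : U → Finset O) (j : O) :
    Finset U :=
  Finset.univ.filter (fun i => j ∈ dplus i)

/-- The true-rating map `R(b)`. -/
noncomputable def Rmap {U O : Type} [Fintype U] [DecidableEq O] (dplus : U → Finset O)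
    (w : U → O → ℝ) (α : ℝ) (b : U → ℝ) (j : O) : ℝ :=
  (∑ i ∈ dminus dplus j, clamp (w i j - α * b i)) / (dminus dplus j).card

/-- The bias-update map `T(b)`. -/
noncomputable def Tmap {U O : Type} [Fintype U] [DecidableEq O] (dplus : U → Finset O)
    (w : U → O → ℝ) (α : ℝ) (b : U → ℝ) (i : U) : ℝ :=
  (∑ j ∈ dplus i, (w i j - Rmap dplus w α b j)) / (dplus i).card

lemma abs_clamp_sub_clamp_le (x y : ℝ) : |clamp x - clamp y| ≤ |x - y| := by
  unfold clamp
  have h₁ := abs_max_sub_max_le_max 0 (min 1 x) 0 (min 1 y)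
  have h₂ := abs_min_sub_min_le_max 1 x 1 y
  simp only [sub_self, abs_zero, abs_nonneg, sup_of_le_right] at h₁ h₂
  exact h₁.trans h₂

lemma abs_average_sub_average_le {ι : Type*} {s : Finset ι} (hs : s.Nonempty) {f g : ι → ℝ}
    {K : ℝ} (h : ∀ i ∈ s, |f i - g i| ≤ K) :
    |(∑ i ∈ s, f i) / s.card - (∑ i ∈ s, g i) / s.card| ≤ K := by
  have hcard : (0 : ℝ) < s.card := by exact_mod_cast hs.card_pos
  rw [← sub_div, ← Finset.sum_sub_distrib, abs_div, abs_of_pos hcard, div_le_iff₀ hcard]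
  calc |∑ i ∈ s, (f i - g i)| ≤ ∑ i ∈ s, |f i - g i| := Finset.abs_sum_le_sum_abs _ _
    _ ≤ s.card • K := Finset.sum_le_card_nsmul _ _ _ h
    _ = K * s.card := by rw [nsmul_eq_mul, mul_comm]

lemma abs_Rmap_sub_Rmap_le {U O : Type} [Fintype U] [DecidableEq O] {dplus : U → Finset O}
    {j : O} (hj : (dminus dplus j).Nonempty) (w : U → O → ℝ) {α : ℝ} (hα : 0 ≤ α)
    (b c : U → ℝ) :
    |Rmap dplus w α b j - Rmap dplus w α c j| ≤ α * dist b c := by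
  refine abs_average_sub_average_le hj fun i _ => ?_
  calc |clamp (w i j - α * b i) - clamp (w i j - α * c i)|
      ≤ |(w i j - α * b i) - (w i j - α * c i)| := abs_clamp_sub_clamp_le _ _
    _ = |α * (c i - b i)| := by congr 1; ring
    _ = α * dist (b i) (c i) := by
      rw [abs_mul, abs_of_nonneg hα, dist_comm, Real.dist_eq]
    _ ≤ α * dist b c := by gcongr; exact dist_le_pi_dist b c i

lemma contractingWith_Tmap {U O : Type} [Fintype U] [DecidableEq O] {dplus : U → Finset O}
    (hd : ∀ i : U, (dplus i).Nonempty) (hdm : ∀ j : O, (dminus dplus j).Nonempty)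
    (w : U → O → ℝ) {α : ℝ} (hα0 : 0 ≤ α) (hα1 : α < 1) :
    ContractingWith ⟨α, hα0⟩ (Tmap dplus w α) := by
  refine ⟨hα1, LipschitzWith.of_dist_le_mul fun b c => ?_⟩
  refine (dist_pi_le_iff (by positivity)).2 fun i => ?_
  rw [Real.dist_eq]
  refine abs_average_sub_average_le (hd i) fun j _ => ?_
  rw [sub_sub_sub_cancel_left, abs_sub_comm]
  exact abs_Rmap_sub_Rmap_le (hdm j) w hα0 b c

lemma isFixedPt_of_tendsto_orbit {X : Type*} [TopologicalSpace X] [T2Space X] {f : X → X}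
    (hf : Continuous f) {x : ℕ → X} (hx : ∀ t, x (t + 1) = f (x t)) {a : X}
    (ha : Filter.Tendsto x Filter.atTop (nhds a)) : Function.IsFixedPt f a := by
  refine tendsto_nhds_unique ((hf.tendsto a).comp ha) ?_
  simpa only [Function.comp_def, ← hx] using ha.comp (Filter.tendsto_add_atTop_nat 1)

theorem limit_independent_of_initial_conditions
    {U O : Type} [Fintype U] [Nonempty U] [Fintype O] [Nonempty O] [DecidableEq O]
    (dplus : U → Finset O) (hd : ∀ i : U, (dplus i).Nonempty)
    (hdm : ∀ j : O, (dminus dplus j).Nonempty)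
    (w : U → O → ℝ) (hw : ∀ i j, w i j ∈ Set.Icc (0 : ℝ) 1)
    (α : ℝ) (hα0 : 0 < α) (hα1 : α < 1)
    (b c : ℕ → U → ℝ)
    (hb : ∀ t, b (t + 1) = Tmap dplus w α (b t))
    (hc : ∀ t, c (t + 1) = Tmap dplus w α (c t))
    (bstar cstar : U → ℝ)
    (hblim : ∀ i : U, Filter.Tendsto (fun t => b t i) Filter.atTop (nhds (bstar i)))
    (hclim : ∀ i : U, Filter.Tendsto (fun t => c t i) Filter.atTop (nhds (cstar i))) :
    bstar = cstar := by
  have hT := contractingWith_Tmap hd hdm w hα0.le hα1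
  have hcont := hT.toLipschitzWith.continuous
  exact hT.fixedPoint_unique'
    (isFixedPt_of_tendsto_orbit hcont hb (tendsto_pi_nhds.2 hblim))
    (isFixedPt_of_tendsto_orbit hcont hc (tendsto_pi_nhds.2 hclim))
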